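/- For each l ≥ 1 there is a constant c₂ > 0 (depending on l) such that for all x ∈ ℝ^d and λ ≥ 0, |grad_x θ^{(l)}(x,λ)| + |Δ_x θ^{(l)}(x,λ)| ≤ c₂ · θ^{(l)}(x,λ). -/

import Mathlib

/-- The iterated-logarithm hierarchy: `iterLog α 0 = α`,
`iterLog α (l+1) = log (e + iterLog α l)`. -/
noncomputable def iterLog (α : ℝ → ℝ) : ℕ → ℝ → ℝ
  | 0 => α
  | l + 1 => fun x => Real.log (Real.exp 1 + iterLog α l x)

/-- The modified `θ`-function
`θ^{(l)}(x,λ) = exp[-(λ/α_l(λ)^{1/2})·(1+λ²+log(1+|x|²)·α_l(√(1+|x|²)))^{1/2}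
                 - log(1+|x|²)·α_l(√(1+|x|²))]`. -/
noncomputable def theta (α : ℝ → ℝ) (l : ℕ) {d : ℕ}
    (x : EuclideanSpace ℝ (Fin d)) (lam : ℝ) : ℝ :=
  Real.exp (-(lam / Real.sqrt (iterLog α l lam)) *
      Real.sqrt (1 + lam ^ 2 +
        Real.log (1 + ‖x‖ ^ 2) * iterLog α l (Real.sqrt (1 + ‖x‖ ^ 2))) -
    Real.log (1 + ‖x‖ ^ 2) * iterLog α l (Real.sqrt (1 + ‖x‖ ^ 2)))

/-- The Laplacian on `ℝ^d` as the sum of the pure second partial derivatives. -/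
noncomputable def laplacian {d : ℕ} (f : EuclideanSpace ℝ (Fin d) → ℝ)
    (x : EuclideanSpace ℝ (Fin d)) : ℝ :=
  ∑ i : Fin d,
    fderiv ℝ (fun y => fderiv ℝ f y (EuclideanSpace.single i 1)) x
      (EuclideanSpace.single i 1)

theorem one_le_iterLog {α : ℝ → ℝ} (h : ∀ s, 0 ≤ s → 1 ≤ α s) (l : ℕ) {s : ℝ} (hs : 0 ≤ s) :
    1 ≤ iterLog α l s := by
  induction l with
  | zero => exact h s hs
  | succ l ih =>
    have : Real.log (Real.exp 1) ≤ Real.log (Real.exp 1 + iterLog α l s) :=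
      Real.log_le_log (Real.exp_pos 1) (by linarith)
    rwa [Real.log_exp] at this

/-- Derivatives of `log (e + b)` and the bounds inherited from those of `b`. -/
theorem log_exp_one_add_jet {b b₁ b₂ : ℝ → ℝ} {C : ℝ}
    (h1 : ∀ s, 1 ≤ s → 1 ≤ b s)
    (hb : ∀ s, 1 ≤ s → HasDerivAt b (b₁ s) s)
    (hb₁ : ∀ s, 1 ≤ s → HasDerivAt b₁ (b₂ s) s)
    (hnn : ∀ s, 1 ≤ s → 0 ≤ b₁ s) (hle : ∀ s, 1 ≤ s → b₁ s ≤ b s / (1 + s))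
    (hb₂ : ∀ s, 1 ≤ s → |b₂ s| ≤ C / (1 + s)) :
    ∃ g₁ g₂ : ℝ → ℝ,
      (∀ s, 1 ≤ s → HasDerivAt (fun x => Real.log (Real.exp 1 + b x)) (g₁ s) s) ∧
      (∀ s, 1 ≤ s → HasDerivAt g₁ (g₂ s) s) ∧
      (∀ s, 1 ≤ s → 0 ≤ g₁ s) ∧ (∀ s, 1 ≤ s → g₁ s ≤ 1 / (1 + s)) ∧
      ∀ s, 1 ≤ s → |g₂ s| ≤ (C + 1) / (1 + s) := by
  have he := Real.exp_pos 1
  refine ⟨fun s => b₁ s / (Real.exp 1 + b s),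
    fun s => (b₂ s * (Real.exp 1 + b s) - b₁ s * b₁ s) / (Real.exp 1 + b s) ^ 2,
    fun s hs => ?_, fun s hs => ?_, fun s hs => ?_, fun s hs => ?_, fun s hs => ?_⟩ <;>
  have hpos : 1 ≤ Real.exp 1 + b s := by linarith [h1 s hs]
  · exact ((hb s hs).const_add _).log (by linarith)
  · exact (hb₁ s hs).div ((hb s hs).const_add _) (by linarith)
  · exact div_nonneg (hnn s hs) (by linarith)
  · rw [div_le_iff₀ (by linarith), one_div_mul_eq_div]
    refine (hle s hs).trans ?_
    gcongr
    linarith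
  · have hq₀ : 0 ≤ b₁ s / (Real.exp 1 + b s) := div_nonneg (hnn s hs) (by linarith)
    have hq : b₁ s / (Real.exp 1 + b s) ≤ 1 / (1 + s) := by
      rw [div_le_iff₀ (by linarith), one_div_mul_eq_div]
      refine (hle s hs).trans ?_
      gcongr
      linarith
    have hs1 : 1 / (1 + s) ≤ 1 := by
      rw [div_le_one (by linarith)]; linarith
    have heq : (b₂ s * (Real.exp 1 + b s) - b₁ s * b₁ s) / (Real.exp 1 + b s) ^ 2 =
        b₂ s / (Real.exp 1 + b s) - (b₁ s / (Real.exp 1 + b s)) ^ 2 := by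
      have : Real.exp 1 + b s ≠ 0 := by linarith
      field_simp
    have ha : |b₂ s / (Real.exp 1 + b s)| ≤ C / (1 + s) := by
      rw [abs_div, abs_of_pos (by linarith : 0 < Real.exp 1 + b s)]
      exact (div_le_self (abs_nonneg _) hpos).trans (hb₂ s hs)
    have hsq : (b₁ s / (Real.exp 1 + b s)) ^ 2 ≤ 1 / (1 + s) := by nlinarith
    beta_reduce
    rw [heq, add_div]
    refine (abs_sub _ _).trans (add_le_add ha ?_)
    rwa [abs_of_nonneg (sq_nonneg _)]

theorem iterLog_succ_jet {α a₁ a₂ : ℝ → ℝ} {c : ℝ}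
    (h1 : ∀ s, 0 ≤ s → 1 ≤ α s)
    (hα : ∀ s, 1 ≤ s → HasDerivAt α (a₁ s) s)
    (ha₁ : ∀ s, 1 ≤ s → HasDerivAt a₁ (a₂ s) s)
    (hnn : ∀ s, 1 ≤ s → 0 ≤ a₁ s) (hle : ∀ s, 1 ≤ s → a₁ s ≤ α s / (1 + s))
    (ha₂ : ∀ s, 1 ≤ s → |a₂ s| ≤ c / (1 + s)) (l : ℕ) :
    ∃ b₁ b₂ : ℝ → ℝ, ∃ C : ℝ,
      (∀ s, 1 ≤ s → HasDerivAt (iterLog α (l + 1)) (b₁ s) s) ∧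
      (∀ s, 1 ≤ s → HasDerivAt b₁ (b₂ s) s) ∧
      (∀ s, 1 ≤ s → 0 ≤ b₁ s) ∧ (∀ s, 1 ≤ s → b₁ s ≤ 1 / (1 + s)) ∧
      ∀ s, 1 ≤ s → |b₂ s| ≤ C / (1 + s) := by
  induction l with
  | zero =>
    obtain ⟨g₁, g₂, h⟩ := log_exp_one_add_jet (fun s hs => h1 s (by linarith)) hα ha₁ hnn hle ha₂
    exact ⟨g₁, g₂, c + 1, h⟩
  | succ l ih =>
    obtain ⟨b₁, b₂, C, hb, hb₁, hn, hl, hb₂⟩ := ih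
    obtain ⟨g₁, g₂, h⟩ := log_exp_one_add_jet
      (fun s hs => one_le_iterLog h1 (l + 1) (by linarith)) hb hb₁ hn
      (fun s hs => (hl s hs).trans (by
        gcongr
        exact one_le_iterLog h1 (l + 1) (by linarith))) hb₂
    exact ⟨g₁, g₂, C + 1, h⟩

/-- The function `2 log s · b s` has bounded first and second derivatives on `[1, ∞)`. -/
theorem two_mul_log_mul_jet {b b₁ b₂ : ℝ → ℝ} {C : ℝ}
    (h1 : ∀ s, 1 ≤ s → 1 ≤ b s)
    (hb : ∀ s, 1 ≤ s → HasDerivAt b (b₁ s) s)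
    (hb₁ : ∀ s, 1 ≤ s → HasDerivAt b₁ (b₂ s) s)
    (hnn : ∀ s, 1 ≤ s → 0 ≤ b₁ s) (hle : ∀ s, 1 ≤ s → b₁ s ≤ 1 / (1 + s))
    (hb₂ : ∀ s, 1 ≤ s → |b₂ s| ≤ C / (1 + s)) :
    ∃ g₁ g₂ : ℝ → ℝ, ∃ B : ℝ, 0 ≤ B ∧
      (∀ s, 1 ≤ s → HasDerivAt (fun x => 2 * Real.log x * b x) (g₁ s) s) ∧
      (∀ s, 1 ≤ s → HasDerivAt g₁ (g₂ s) s) ∧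
      (∀ s, 1 ≤ s → |g₁ s| ≤ B) ∧ ∀ s, 1 ≤ s → |g₂ s| ≤ B := by
  have hK : ∀ s, 1 ≤ s → b s ≤ b 1 * s := by
    intro s hs
    have := (convex_Ici (1 : ℝ)).image_sub_le_mul_sub_of_deriv_le (f := b) (C := 1)
      (fun x hx => (hb x hx).continuousAt.continuousWithinAt)
      (fun x hx => (hb x (interior_subset hx)).differentiableAt.differentiableWithinAt)
      (fun x hx => by
        have hx : 1 ≤ x := interior_subset hx
        rw [(hb x hx).deriv]
        refine (hle x hx).trans ?_
        rw [div_le_one (by linarith)]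
        linarith)
      1 Set.self_mem_Ici s hs hs
    nlinarith [h1 1 le_rfl]
  have hC : 0 ≤ C := by
    have := (abs_nonneg _).trans (hb₂ 1 le_rfl)
    by_contra! h
    linarith [div_neg_of_neg_of_pos h (by norm_num : (0 : ℝ) < 1 + 1)]
  have hb10 := h1 1 le_rfl
  refine ⟨fun s => 2 * b s / s + 2 * Real.log s * b₁ s,
    fun s => (2 * b₁ s * s - 2 * b s) / s ^ 2 + (2 * s⁻¹ * b₁ s + 2 * Real.log s * b₂ s),
    2 * b 1 + 4 + 2 * C, by linarith, fun s hs => ?_, fun s hs => ?_, fun s hs => ?_,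
    fun s hs => ?_⟩ <;>
  have hs0 : 0 < s := by linarith
  · refine (((Real.hasDerivAt_log hs0.ne').const_mul 2).mul (hb s hs)).congr_deriv ?_
    ring
  · refine ((((hb s hs).const_mul 2).div (hasDerivAt_id s) hs0.ne').add
      (((Real.hasDerivAt_log hs0.ne').const_mul 2).mul (hb₁ s hs))).congr_deriv ?_
    simp
  all_goals
    have hlog0 : 0 ≤ Real.log s := Real.log_nonneg hs
    have hlog : Real.log s ≤ 1 + s := by linarith [Real.log_le_sub_one_of_pos hs0]
    have hbs := h1 s hs
    have hlb : Real.log s * b₁ s ≤ 1 := by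
      calc Real.log s * b₁ s ≤ (1 + s) * (1 / (1 + s)) :=
            mul_le_mul hlog (hle s hs) (hnn s hs) (by linarith)
        _ = 1 := mul_one_div_cancel (by linarith)
    have hbd : b s / s ≤ b 1 := by rw [div_le_iff₀ hs0]; exact hK s hs
    have hbd0 : 0 ≤ b s / s := by positivity
    have hlb0 := mul_nonneg hlog0 (hnn s hs)
  · beta_reduce
    rw [abs_le, mul_div_assoc, mul_assoc]
    constructor <;> linarith
  · have hlb2 : |Real.log s * b₂ s| ≤ C := by
      rw [abs_mul, abs_of_nonneg hlog0]
      calc Real.log s * |b₂ s| ≤ (1 + s) * (C / (1 + s)) :=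
            mul_le_mul hlog (hb₂ s hs) (abs_nonneg _) (by linarith)
        _ = C := mul_div_cancel₀ _ (by linarith)
    have hinv : s⁻¹ ≤ 1 := inv_le_one_of_one_le₀ hs
    have hinv0 : 0 < s⁻¹ := inv_pos.mpr hs0
    have hb1 : b₁ s ≤ 1 := (hle s hs).trans (by
      rw [div_le_one (by linarith)]; linarith)
    have hp : s⁻¹ * b₁ s ≤ 1 := mul_le_one₀ hinv (hnn s hs) hb1
    have hp0 : 0 ≤ s⁻¹ * b₁ s := mul_nonneg hinv0.le (hnn s hs)
    have hq : s⁻¹ * (b s / s) ≤ b 1 := by nlinarith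
    have hq0 : 0 ≤ s⁻¹ * (b s / s) := by positivity
    have heq : (2 * b₁ s * s - 2 * b s) / s ^ 2 + (2 * s⁻¹ * b₁ s + 2 * Real.log s * b₂ s) =
        4 * (s⁻¹ * b₁ s) - 2 * (s⁻¹ * (b s / s)) + 2 * (Real.log s * b₂ s) := by
      field_simp
      ring
    rw [abs_le] at hlb2
    beta_reduce
    rw [heq, abs_le]
    constructor <;> linarith [hlb2.1, hlb2.2]

/-- If `H ≥ 0` has bounded derivatives, then those of
`exp (-m √(1 + λ² + H) - H)` are bounded by a multiple of the function itself,
uniformly in `0 ≤ m ≤ λ`. -/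
theorem exp_neg_sqrt_sub_jet {H H₁ H₂ : ℝ → ℝ} {B m lam : ℝ} (hm : 0 ≤ m) (hml : m ≤ lam)
    (hB : 0 ≤ B) (hnn : ∀ s, 1 ≤ s → 0 ≤ H s)
    (hH : ∀ s, 1 ≤ s → HasDerivAt H (H₁ s) s) (hH₁ : ∀ s, 1 ≤ s → HasDerivAt H₁ (H₂ s) s)
    (hb₁ : ∀ s, 1 ≤ s → |H₁ s| ≤ B) (hb₂ : ∀ s, 1 ≤ s → |H₂ s| ≤ B) :
    ∃ E₁ E₂ : ℝ → ℝ,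
      (∀ s, 1 ≤ s → HasDerivAt
        (fun x => Real.exp (-m * Real.sqrt (1 + lam ^ 2 + H x) - H x)) (E₁ s) s) ∧
      (∀ s, 1 ≤ s → HasDerivAt E₁ (E₂ s) s) ∧
      (∀ s, 1 ≤ s → |E₁ s| ≤ 2 * B * Real.exp (-m * Real.sqrt (1 + lam ^ 2 + H s) - H s)) ∧
      ∀ s, 1 ≤ s →
        |E₂ s| ≤ (2 * B + 5 * B ^ 2) * Real.exp (-m * Real.sqrt (1 + lam ^ 2 + H s) - H s) := by
  set R : ℝ → ℝ := fun x => Real.sqrt (1 + lam ^ 2 + H x) with hR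
  set E : ℝ → ℝ := fun x => Real.exp (-m * R x - H x) with hE
  have hR1 : ∀ s, 1 ≤ s → HasDerivAt R (H₁ s / (2 * R s)) s := fun s hs =>
    ((hH s hs).const_add _).sqrt (by have := hnn s hs; positivity)
  have hRge : ∀ s, 1 ≤ s → 1 ≤ R s ∧ m ≤ R s := by
    intro s hs
    have := hnn s hs
    exact ⟨Real.one_le_sqrt.mpr (by nlinarith), Real.le_sqrt_of_sq_le (by nlinarith)⟩
  have hE1 : ∀ s, 1 ≤ s → HasDerivAt E (-(E s * ((m / R s / 2 + 1) * H₁ s))) s := by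
    intro s hs
    refine (((hR1 s hs).const_mul (-m)).sub (hH s hs)).exp.congr_deriv ?_
    have : R s ≠ 0 := by linarith [(hRge s hs).1]
    change E s * _ = _
    field_simp
    ring
  refine ⟨fun s => -(E s * ((m / R s / 2 + 1) * H₁ s)),
    fun s => E s * (((m / R s / 2 + 1) * H₁ s) ^ 2 + (m / R s / (4 * R s ^ 2)) * H₁ s ^ 2
      - (m / R s / 2 + 1) * H₂ s),
    hE1, fun s hs => ?_, fun s hs => ?_, fun s hs => ?_⟩ <;>
  have hR0 : 0 < R s := by linarith [(hRge s hs).1]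
  · have hd : HasDerivAt (fun s => m / R s / 2 + 1)
        ((0 * R s - m * (H₁ s / (2 * R s))) / R s ^ 2 / 2) s :=
      (((hasDerivAt_const s m).div (hR1 s hs) hR0.ne').div_const 2).add_const 1
    refine ((hE1 s hs).mul (hd.mul (hH₁ s hs))).neg.congr_deriv ?_
    simp only [Pi.mul_apply]
    field_simp
    ring
  all_goals
    have hE0 : 0 < E s := Real.exp_pos _
    have hq0 : 0 ≤ m / R s := by positivity
    have hq : m / R s ≤ 1 := (div_le_one hR0).mpr (hRge s hs).2
    have hp0 : 0 ≤ m / R s / 2 + 1 := by linarith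
    have hp : m / R s / 2 + 1 ≤ 2 := by linarith
    have hP : |(m / R s / 2 + 1) * H₁ s| ≤ 2 * B := by
      rw [abs_mul, abs_of_nonneg hp0]
      exact mul_le_mul hp (hb₁ s hs) (abs_nonneg _) (by norm_num)
  · beta_reduce
    rw [abs_neg, abs_mul, abs_of_pos hE0, mul_comm]
    gcongr
  · have hP2 : |(m / R s / 2 + 1) * H₂ s| ≤ 2 * B := by
      rw [abs_mul, abs_of_nonneg hp0]
      exact mul_le_mul hp (hb₂ s hs) (abs_nonneg _) (by norm_num)
    have hPsq : ((m / R s / 2 + 1) * H₁ s) ^ 2 ≤ (2 * B) ^ 2 := sq_le_sq.mpr (by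
      rwa [abs_of_nonneg (by linarith : 0 ≤ 2 * B)])
    have hHsq : H₁ s ^ 2 ≤ B ^ 2 := sq_le_sq.mpr (by rw [abs_of_nonneg hB]; exact hb₁ s hs)
    have hr : m / R s / (4 * R s ^ 2) ≤ 1 := by
      rw [div_le_one (by positivity)]
      nlinarith [(hRge s hs).1]
    have hr0 : 0 ≤ m / R s / (4 * R s ^ 2) := by positivity
    have hmix : m / R s / (4 * R s ^ 2) * H₁ s ^ 2 ≤ B ^ 2 := by
      nlinarith [sq_nonneg (H₁ s)]
    have hmix0 : 0 ≤ m / R s / (4 * R s ^ 2) * H₁ s ^ 2 := by positivity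
    beta_reduce
    rw [abs_mul, abs_of_pos hE0, mul_comm]
    gcongr
    rw [abs_le] at hP2 ⊢
    constructor <;> nlinarith [hP2.1, hP2.2, sq_nonneg ((m / R s / 2 + 1) * H₁ s)]

theorem hasFDerivAt_comp_norm_sq {F : Type*} [NormedAddCommGroup F] [InnerProductSpace ℝ F]
    {φ : ℝ → ℝ} {φ' : ℝ} {x : F} (h : HasDerivAt φ φ' (‖x‖ ^ 2)) :
    HasFDerivAt (fun y : F => φ (‖y‖ ^ 2)) ((2 * φ') • innerSL ℝ x) x := by
  refine (h.comp_hasFDerivAt x (hasStrictFDerivAt_norm_sq x).hasFDerivAt).congr_fderiv ?_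
  ext v
  simp
  ring

theorem norm_gradient_comp_norm_sq {F : Type*} [NormedAddCommGroup F] [InnerProductSpace ℝ F]
    [CompleteSpace F] {φ : ℝ → ℝ} {φ' : ℝ} {x : F} (h : HasDerivAt φ φ' (‖x‖ ^ 2)) :
    ‖gradient (fun y : F => φ (‖y‖ ^ 2)) x‖ = 2 * |φ'| * ‖x‖ := by
  rw [gradient, LinearIsometryEquiv.norm_map, (hasFDerivAt_comp_norm_sq h).fderiv, norm_smul,
    innerSL_apply_norm, Real.norm_eq_abs, abs_mul, abs_two]

theorem laplacian_comp_norm_sq {d : ℕ} {φ φ₁ φ₂ : ℝ → ℝ}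
    (h : ∀ t, 0 ≤ t → HasDerivAt φ (φ₁ t) t) (h₁ : ∀ t, 0 ≤ t → HasDerivAt φ₁ (φ₂ t) t)
    (x : EuclideanSpace ℝ (Fin d)) :
    laplacian (fun y => φ (‖y‖ ^ 2)) x =
      4 * φ₂ (‖x‖ ^ 2) * ‖x‖ ^ 2 + 2 * d * φ₁ (‖x‖ ^ 2) := by
  have key (i : Fin d) : fderiv ℝ (fun y : EuclideanSpace ℝ (Fin d) =>
      fderiv ℝ (fun y => φ (‖y‖ ^ 2)) y (EuclideanSpace.single i 1)) x
        (EuclideanSpace.single i 1) = 4 * φ₂ (‖x‖ ^ 2) * x i ^ 2 + 2 * φ₁ (‖x‖ ^ 2) := by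
    have heq : (fun y : EuclideanSpace ℝ (Fin d) =>
        fderiv ℝ (fun y => φ (‖y‖ ^ 2)) y (EuclideanSpace.single i 1)) =
        fun y => (2 * φ₁ (‖y‖ ^ 2)) * EuclideanSpace.proj (𝕜 := ℝ) i y := by
      funext y
      rw [(hasFDerivAt_comp_norm_sq (h _ (sq_nonneg ‖y‖))).fderiv]
      simp [EuclideanSpace.inner_single_right]
    have hprod := ((hasFDerivAt_comp_norm_sq (h₁ _ (sq_nonneg ‖x‖))).const_mul 2).mul
      (EuclideanSpace.proj (𝕜 := ℝ) i).hasFDerivAt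
    rw [heq]
    refine (congrArg (fun L => L (EuclideanSpace.single i 1)) hprod.fderiv).trans ?_
    simp [EuclideanSpace.inner_single_right]
    ring
  simp only [laplacian, key, Finset.sum_add_distrib, ← Finset.mul_sum,
    ← EuclideanSpace.real_norm_sq_eq, Finset.sum_const, Finset.card_univ, Fintype.card_fin,
    nsmul_eq_mul]
  ring

/-- Gradient and Laplacian bounds for a function of `√(1 + ‖x‖²)`. -/
theorem norm_gradient_add_abs_laplacian_le {d : ℕ} {E E₁ E₂ : ℝ → ℝ}
    (h : ∀ s, 1 ≤ s → HasDerivAt E (E₁ s) s) (h₁ : ∀ s, 1 ≤ s → HasDerivAt E₁ (E₂ s) s)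
    (x : EuclideanSpace ℝ (Fin d)) :
    ‖gradient (fun y : EuclideanSpace ℝ (Fin d) => E (Real.sqrt (1 + ‖y‖ ^ 2))) x‖ +
      |laplacian (fun y : EuclideanSpace ℝ (Fin d) => E (Real.sqrt (1 + ‖y‖ ^ 2))) x| ≤
      (2 + d) * |E₁ (Real.sqrt (1 + ‖x‖ ^ 2))| + |E₂ (Real.sqrt (1 + ‖x‖ ^ 2))| := by
  have hu : ∀ t : ℝ, 0 ≤ t → 1 ≤ Real.sqrt (1 + t) := fun t ht =>
    Real.one_le_sqrt.mpr (by linarith)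
  have hsq : ∀ t : ℝ, 0 ≤ t → HasDerivAt (fun t : ℝ => Real.sqrt (1 + t))
      (1 / (2 * Real.sqrt (1 + t))) t := fun t ht =>
    ((hasDerivAt_id t).const_add 1).sqrt (by simp only [id]; linarith)
  have hφ : ∀ t, 0 ≤ t → HasDerivAt (fun t => E (Real.sqrt (1 + t)))
      (E₁ (Real.sqrt (1 + t)) / (2 * Real.sqrt (1 + t))) t := by
    intro t ht
    refine ((h _ (hu t ht)).comp t (hsq t ht)).congr_deriv ?_
    ring
  have hφ₁ : ∀ t, 0 ≤ t → HasDerivAt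
      (fun t => E₁ (Real.sqrt (1 + t)) / (2 * Real.sqrt (1 + t)))
      (E₂ (Real.sqrt (1 + t)) / (4 * Real.sqrt (1 + t) ^ 2) -
        E₁ (Real.sqrt (1 + t)) / (4 * Real.sqrt (1 + t) ^ 3)) t := by
    intro t ht
    have h0 : 0 < Real.sqrt (1 + t) := by linarith [hu t ht]
    refine (((h₁ _ (hu t ht)).comp t (hsq t ht)).div ((hsq t ht).const_mul 2)
      (by positivity)).congr_deriv ?_
    simp only [Function.comp]
    field_simp
    ring
  rw [norm_gradient_comp_norm_sq (φ := fun t => E (Real.sqrt (1 + t))) (hφ _ (sq_nonneg ‖x‖)),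
    laplacian_comp_norm_sq (φ := fun t => E (Real.sqrt (1 + t))) hφ hφ₁]
  have hu1 := hu _ (sq_nonneg ‖x‖)
  have hu2 : Real.sqrt (1 + ‖x‖ ^ 2) ^ 2 = 1 + ‖x‖ ^ 2 := Real.sq_sqrt (by positivity)
  have hxu : ‖x‖ ≤ Real.sqrt (1 + ‖x‖ ^ 2) := Real.le_sqrt_of_sq_le (by linarith)
  generalize Real.sqrt (1 + ‖x‖ ^ 2) = u at *
  have hu0 : 0 < u := by linarith
  have hr : ‖x‖ / u ≤ 1 := (div_le_one hu0).mpr hxu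
  have hr0 : 0 ≤ ‖x‖ / u := by positivity
  have hr2 : (‖x‖ / u) ^ 2 ≤ 1 := pow_le_one₀ hr0 hr
  have hi : u⁻¹ ≤ 1 := inv_le_one_of_one_le₀ hu1
  have hi0 : 0 < u⁻¹ := inv_pos.mpr hu0
  have e1 : 2 * |E₁ u / (2 * u)| * ‖x‖ = ‖x‖ / u * |E₁ u| := by
    rw [abs_div, abs_of_pos (by positivity : 0 < 2 * u)]
    field_simp
  have e2 : 4 * (E₂ u / (4 * u ^ 2) - E₁ u / (4 * u ^ 3)) * ‖x‖ ^ 2 + 2 * d * (E₁ u / (2 * u)) =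
      (‖x‖ / u) ^ 2 * E₂ u - (‖x‖ / u) ^ 2 * u⁻¹ * E₁ u + d * u⁻¹ * E₁ u := by
    field_simp
  have hri : (‖x‖ / u) ^ 2 * u⁻¹ ≤ 1 := mul_le_one₀ hr2 hi0.le hi
  rw [e1, e2]
  calc ‖x‖ / u * |E₁ u| +
        |(‖x‖ / u) ^ 2 * E₂ u - (‖x‖ / u) ^ 2 * u⁻¹ * E₁ u + d * u⁻¹ * E₁ u|
      ≤ ‖x‖ / u * |E₁ u| + ((‖x‖ / u) ^ 2 * |E₂ u| + (‖x‖ / u) ^ 2 * u⁻¹ * |E₁ u| +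
          d * u⁻¹ * |E₁ u|) := by
        gcongr
        refine (abs_add_le _ _).trans (add_le_add ((abs_sub _ _).trans_eq ?_) ?_)
        · rw [abs_mul, abs_mul _ (E₁ u), abs_of_nonneg (by positivity : 0 ≤ (‖x‖ / u) ^ 2),
            abs_of_nonneg (by positivity : 0 ≤ (‖x‖ / u) ^ 2 * u⁻¹)]
        · rw [abs_mul, abs_of_nonneg (by positivity : 0 ≤ (d : ℝ) * u⁻¹)]
    _ ≤ 1 * |E₁ u| + (1 * |E₂ u| + 1 * |E₁ u| + d * 1 * |E₁ u|) := by gcongr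
    _ = (2 + d) * |E₁ u| + |E₂ u| := by ring

theorem deriv_deriv_nonpos_of_concaveOn_Ici {α : ℝ → ℝ} (hd1 : Differentiable ℝ α)
    (hconc : ConcaveOn ℝ (Set.Ici 0) α) {s : ℝ} (hs : 0 < s) : deriv (deriv α) s ≤ 0 := by
  have hanti : AntitoneOn (deriv α) (Set.Ioi 0) :=
    (hconc.subset Set.Ioi_subset_Ici_self (convex_Ioi 0)).antitoneOn_deriv
      (fun x _ => hd1 x)
  rw [← derivWithin_of_isOpen isOpen_Ioi (Set.mem_Ioi.mpr hs)]
  exact hanti.derivWithin_nonpos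

theorem deriv_nonneg_of_monotoneOn_Ici {α : ℝ → ℝ} (hmono : MonotoneOn α (Set.Ici 0))
    {s : ℝ} (hs : 0 < s) : 0 ≤ deriv α s := by
  rw [← derivWithin_of_isOpen isOpen_Ioi (Set.mem_Ioi.mpr hs)]
  exact (hmono.mono Set.Ioi_subset_Ici_self).derivWithin_nonneg

/-- Lemma A.1'(b): gradient and Laplacian bound for `θ^{(l)}`. -/
theorem stmt_8 (d : ℕ) (α : ℝ → ℝ) (c : ℝ) (hc : 0 < c)
    (hd1 : Differentiable ℝ α)
    (hd2 : Differentiable ℝ (deriv α))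
    (hmono : MonotoneOn α (Set.Ici 0))
    (hconc : ConcaveOn ℝ (Set.Ici 0) α)
    (h0 : 1 ≤ α 0)
    (htend : Filter.Tendsto α Filter.atTop Filter.atTop)
    (hder : ∀ x : ℝ, 0 ≤ x → deriv α x ≤ α x / (1 + x))
    (hder2 : ∀ x : ℝ, 0 ≤ x → -(c / (1 + x)) ≤ deriv (deriv α) x) :
    ∀ l : ℕ, 1 ≤ l → ∃ c₂ > (0:ℝ),
      ∀ (x : EuclideanSpace ℝ (Fin d)) (lam : ℝ), 0 ≤ lam →
        ‖gradient (fun y => theta α l y lam) x‖ +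
            |laplacian (fun y => theta α l y lam) x| ≤ c₂ * theta α l x lam := by
  intro l hl
  obtain ⟨k, rfl⟩ := Nat.exists_eq_add_of_le' hl
  have h1 : ∀ s, 0 ≤ s → 1 ≤ α s := fun s hs =>
    h0.trans (hmono Set.self_mem_Ici hs hs)
  obtain ⟨b₁, b₂, C, hb, hb₁, hnn, hle, hb₂⟩ := iterLog_succ_jet (c := c) h1
    (fun s _ => (hd1 s).hasDerivAt) (fun s _ => (hd2 s).hasDerivAt)
    (fun s hs => deriv_nonneg_of_monotoneOn_Ici hmono (by linarith))
    (fun s hs => hder s (by linarith))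
    (fun s hs => abs_le.mpr ⟨hder2 s (by linarith),
      (deriv_deriv_nonpos_of_concaveOn_Ici hd1 hconc (by linarith)).trans
        (div_nonneg hc.le (by linarith))⟩) k
  have hge : ∀ s, 0 ≤ s → 1 ≤ iterLog α (k + 1) s := fun s hs => one_le_iterLog h1 (k + 1) hs
  obtain ⟨H₁, H₂, B, hB, hH, hH₁, hB₁, hB₂⟩ := two_mul_log_mul_jet
    (fun s hs => hge s (by linarith)) hb hb₁ hnn hle hb₂
  refine ⟨(2 + d) * (2 * B) + (2 * B + 5 * B ^ 2) + 1, by positivity, fun x lam hlam => ?_⟩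
  have hml : lam / Real.sqrt (iterLog α (k + 1) lam) ≤ lam :=
    div_le_self hlam (Real.one_le_sqrt.mpr (hge lam hlam))
  obtain ⟨E₁, E₂, hE, hE₁, hbE₁, hbE₂⟩ := exp_neg_sqrt_sub_jet
    (div_nonneg hlam (Real.sqrt_nonneg _)) hml hB
    (fun s hs => mul_nonneg (mul_nonneg zero_le_two (Real.log_nonneg hs))
      (by linarith [hge s (by linarith)])) hH hH₁ hB₁ hB₂
  have hlog (y : EuclideanSpace ℝ (Fin d)) :
      Real.log (1 + ‖y‖ ^ 2) = 2 * Real.log (Real.sqrt (1 + ‖y‖ ^ 2)) := by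
    rw [Real.log_sqrt (by positivity)]
    ring
  have hu : 1 ≤ Real.sqrt (1 + ‖x‖ ^ 2) := Real.one_le_sqrt.mpr (by nlinarith [sq_nonneg ‖x‖])
  simp only [theta, hlog]
  refine (norm_gradient_add_abs_laplacian_le hE hE₁ x).trans ?_
  have hx₁ := hbE₁ _ hu
  have hx₂ := hbE₂ _ hu
  have hd : (0 : ℝ) ≤ 2 + d := by positivity
  have := mul_le_mul_of_nonneg_left hx₁ hd
  rw [add_mul _ (1 : ℝ), add_mul ((2 + d) * (2 * B)), one_mul, mul_assoc (2 + (d : ℝ))]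
  exact (add_le_add this hx₂).trans (le_add_of_nonneg_right (Real.exp_nonneg _))
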